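/- arXiv:1303.2926 — 10 statements merged into one kernel-verified Lean document; each statement's English description precedes it below -/
import Mathlib

section
/- A partial order P has no infinite antichains if and only if every initial interval of P is a finite union of ideals. -/
/-- An ideal of a partial order: a lower set (initial interval) in which any two
elements have a common upper bound lying in the set. -/
def IsIdealPO {α : Type*} [PartialOrder α] (A : Set α) : Prop :=
  IsLowerSet A ∧ ∀ x ∈ A, ∀ y ∈ A, ∃ z ∈ A, x ≤ z ∧ y ≤ z

/-- Two elements are compatible in `I` if they have a common upper bound lying in `I`. -/
def CompatibleIn {α : Type*} [PartialOrder α] (I : Set α) (x y : α) : Prop :=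
  ∃ z ∈ I, x ≤ z ∧ y ≤ z

/-- The elements of `I` above `x` are pairwise compatible in `I`. -/
def DirectedAbove {α : Type*} [PartialOrder α] (I : Set α) (x : α) : Prop :=
  ∀ u ∈ I, x ≤ u → ∀ v ∈ I, x ≤ v → CompatibleIn I u v

theorem CompatibleIn.symm {α : Type*} [PartialOrder α] {I : Set α} {x y : α}
    (h : CompatibleIn I x y) : CompatibleIn I y x :=
  let ⟨z, hz, hx, hy⟩ := h
  ⟨z, hz, hy, hx⟩

theorem CompatibleIn.mono_left {α : Type*} [PartialOrder α] {I : Set α} {x x' y : α}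
    (h : CompatibleIn I x y) (hx : x' ≤ x) : CompatibleIn I x' y :=
  let ⟨z, hz, hxz, hyz⟩ := h
  ⟨z, hz, hx.trans hxz, hyz⟩

theorem isAntichain_of_pairwise_not_compatibleIn {α : Type*} [PartialOrder α] {I D : Set α}
    (hDI : D ⊆ I) (hD : D.Pairwise fun x y => ¬ CompatibleIn I x y) :
    IsAntichain (· ≤ ·) D :=
  fun _ hx y hy hxy hle => hD hx hy hxy ⟨y, hDI hy, hle, le_rfl⟩

theorem exists_directedAbove_ge {α : Type*} [PartialOrder α]
    (h : ∀ D : Set α, IsAntichain (· ≤ ·) D → D.Finite) (I : Set α) {x : α} (hx : x ∈ I) :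
    ∃ y ∈ I, x ≤ y ∧ DirectedAbove I y := by
  by_contra hne
  let Bad : Type _ := {b : α // b ∈ I ∧ x ≤ b}
  have step : ∀ b : Bad, ∃ (c : Bad) (y : α),
      b.1 ≤ c.1 ∧ b.1 ≤ y ∧ y ∈ I ∧ ¬ CompatibleIn I y c.1 := by
    rintro ⟨b, hbI, hxb⟩
    have hb : ¬ DirectedAbove I b := fun hd => hne ⟨b, hbI, hxb, hd⟩
    simp only [DirectedAbove, not_forall] at hb
    obtain ⟨u, hu, hbu, v, hv, hbv, huv⟩ := hb
    exact ⟨⟨v, hv, hxb.trans hbv⟩, u, hbv, hbu, hu, huv⟩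
  choose f g hf hg hgI hfg using step
  let s : ℕ → Bad := fun n => f^[n] ⟨x, hx, le_rfl⟩
  have hs : ∀ n, s (n + 1) = f (s n) := fun n => Function.iterate_succ_apply' f n _
  have hmono : Monotone fun n => (s n).1 :=
    monotone_nat_of_le_succ fun n => by
      rw [hs]
      exact hf _
  have hlt : ∀ m n, m < n → ¬ CompatibleIn I (g (s m)) (g (s n)) := by
    intro m n hmn hc
    apply hfg (s m)
    rw [← hs]
    exact (hc.symm.mono_left ((hmono (Nat.succ_le_of_lt hmn)).trans (hg (s n)))).symm
  have hinc : ∀ m n, m ≠ n → ¬ CompatibleIn I (g (s m)) (g (s n)) := fun m n hmn hc =>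
    hmn.lt_or_gt.elim (fun hl => hlt m n hl hc) (fun hl => hlt n m hl hc.symm)
  have hinj : Function.Injective fun n => g (s n) := by
    intro m n hmn
    by_contra hne'
    exact hinc m n hne' ⟨g (s n), hgI _, le_of_eq hmn, le_rfl⟩
  refine Set.infinite_range_of_injective hinj
    (h _ (isAntichain_of_pairwise_not_compatibleIn (I := I) ?_ ?_))
  · rintro _ ⟨n, rfl⟩
    exact hgI _
  · rintro _ ⟨m, rfl⟩ _ ⟨n, rfl⟩ hmn
    exact hinc m n fun hEq => hmn (by rw [hEq])

theorem DirectedAbove.isIdealPO {α : Type*} [PartialOrder α] {I : Set α} {m : α}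
    (hm : DirectedAbove I m) : IsIdealPO {z | CompatibleIn I z m} := by
  refine ⟨fun a b hba ha => CompatibleIn.mono_left ha hba, ?_⟩
  rintro a ⟨u, hu, hau, hmu⟩ b ⟨v, hv, hbv, hmv⟩
  obtain ⟨w, hw, huw, hvw⟩ := hm u hu hmu v hv hmv
  exact ⟨w, ⟨w, hw, le_rfl, hmu.trans huw⟩, hau.trans huw, hbv.trans hvw⟩

theorem exists_finset_isIdealPO_of_finite_antichains {α : Type*} [PartialOrder α]
    (h : ∀ D : Set α, IsAntichain (· ≤ ·) D → D.Finite) {I : Set α} (hI : IsLowerSet I) :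
    ∃ F : Finset (Set α), (∀ A ∈ F, IsIdealPO A) ∧ I = ⋃₀ ↑F := by
  classical
  let r : {x : α // x ∈ I ∧ DirectedAbove I x} → {x : α // x ∈ I ∧ DirectedAbove I x} → Prop :=
    fun x y => ¬ CompatibleIn I x.1 y.1
  have hr : ∀ x y, r x y → r y x := fun x y hxy hc => hxy hc.symm
  obtain ⟨hchain, hmax⟩ := maxChain_spec (r := r)
  have hfin : (Subtype.val '' maxChain r).Finite := by
    refine h _ (isAntichain_of_pairwise_not_compatibleIn (I := I) ?_ ?_)
    · rintro _ ⟨x, -, rfl⟩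
      exact x.2.1
    · rintro _ ⟨x, hx, rfl⟩ _ ⟨y, hy, rfl⟩ hxy
      exact (hchain hx hy fun hEq => hxy (by rw [hEq])).elim id (hr y x)
  refine ⟨hfin.toFinset.image fun m => {z | CompatibleIn I z m}, ?_, ?_⟩
  · intro A hA
    simp only [Finset.mem_image, Set.Finite.mem_toFinset] at hA
    obtain ⟨_, ⟨m, -, rfl⟩, rfl⟩ := hA
    exact m.2.2.isIdealPO
  · ext z
    simp only [Set.mem_sUnion, Finset.mem_coe, Finset.mem_image, Set.Finite.mem_toFinset]
    constructor
    · intro hz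
      obtain ⟨y, hyI, hzy, hy⟩ := exists_directedAbove_ge h I hz
      suffices hcompat : ∃ m ∈ maxChain r, CompatibleIn I y m.1 by
        obtain ⟨m, hm, hc⟩ := hcompat
        exact ⟨_, ⟨m.1, ⟨m, hm, rfl⟩, rfl⟩, hc.mono_left hzy⟩
      by_contra! hno
      have hEq := hmax (hchain.insert (a := ⟨y, hyI, hy⟩) fun m hm _ => Or.inl (hno m hm))
        (Set.subset_insert _ _)
      have hmem : (⟨y, hyI, hy⟩ : {x : α // x ∈ I ∧ DirectedAbove I x}) ∈ maxChain r := by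
        rw [hEq]
        exact Set.mem_insert _ _
      exact hno _ hmem ⟨y, hyI, le_rfl, le_rfl⟩
    · rintro ⟨_, ⟨m, -, rfl⟩, w, hw, hzw, -⟩
      exact hI hzw hw

theorem IsAntichain.finite_of_lowerClosure_eq_sUnion {α : Type*} [PartialOrder α] {D : Set α}
    (hD : IsAntichain (· ≤ ·) D) {F : Finset (Set α)} (hF : ∀ A ∈ F, IsIdealPO A)
    (hDF : (lowerClosure D : Set α) = ⋃₀ ↑F) : D.Finite := by
  have hex : ∀ d ∈ D, ∃ A ∈ F, d ∈ A := fun d hd => by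
    have hmem : d ∈ (lowerClosure D : Set α) := subset_lowerClosure hd
    rw [hDF] at hmem
    exact hmem
  choose! f hfF hf using hex
  refine Set.Finite.of_injOn (f := f) (t := (↑F : Set (Set α))) hfF ?_ F.finite_toSet
  intro a ha b hb hab
  obtain ⟨z, hz, haz, hbz⟩ := (hF _ (hfF a ha)).2 a (hf a ha) b (by rw [hab]; exact hf b hb)
  have hzD : z ∈ (lowerClosure D : Set α) := by
    rw [hDF]
    exact ⟨_, hfF a ha, hz⟩
  obtain ⟨d, hd, hzd⟩ := hzD
  exact (hD.eq ha hd (haz.trans hzd)).trans (hD.eq hb hd (hbz.trans hzd)).symm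

/-- A partial order has no infinite antichains iff every initial interval
is a finite union of ideals. -/
theorem stmt0 {α : Type*} [PartialOrder α] :
    (∀ D : Set α, IsAntichain (· ≤ ·) D → D.Finite) ↔
      (∀ I : Set α, IsLowerSet I →
        ∃ F : Finset (Set α), (∀ A ∈ F, IsIdealPO A) ∧ I = ⋃₀ ↑F) := by
  refine ⟨fun h I hI => exists_finset_isIdealPO_of_finite_antichains h hI, fun h D hD => ?_⟩
  obtain ⟨F, hF, hDF⟩ := h (lowerClosure D) (lowerClosure D).lower
  exact hD.finite_of_lowerClosure_eq_sUnion hF hDF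
end

section
/- If every strong antichain in a partial order P is finite, then there is a natural number n such that every strong antichain in P has at most n elements (i.e., P has no arbitrarily large finite strong antichains). -/
/-- A strong antichain: a set of pairwise incompatible elements (no two distinct
elements have a common upper bound). -/
def IsStrongAntichainPO {α : Type*} [PartialOrder α] (S : Set α) : Prop :=
  ∀ x ∈ S, ∀ y ∈ S, x ≠ y → ¬ ∃ z, x ≤ z ∧ y ≤ z

/-- If all strong antichains are finite, then above every element there is one any two of whose
upper bounds are compatible. -/
theorem exists_le_forall_compatible {α : Type*} [PartialOrder α]
    (h : ∀ S : Set α, IsStrongAntichainPO S → S.Finite) (p : α) :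
    ∃ q, p ≤ q ∧ ∀ x y, q ≤ x → q ≤ y → ∃ z, x ≤ z ∧ y ≤ z := by
  by_contra! H
  choose! f g hf hg hfg using H
  let u : ℕ → α := fun n => f^[n] p
  have u_succ (n : ℕ) : u (n + 1) = f (u n) := Function.iterate_succ_apply' f n p
  have p_le (n : ℕ) : p ≤ u n := by
    induction n with
    | zero => exact le_rfl
    | succ n ih => rw [u_succ]; exact ih.trans (hf _ ih)
  have u_mono : Monotone u :=
    monotone_nat_of_le_succ fun n => by rw [u_succ]; exact hf _ (p_le n)
  have incompatible {m n : ℕ} (hmn : m < n) (z : α) (hm : g (u m) ≤ z) : ¬ g (u n) ≤ z := by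
    intro hn
    refine hfg (u m) (p_le m) z ?_ hm
    rw [← u_succ]
    exact ((u_mono hmn).trans (hg _ (p_le n))).trans hn
  have inj : Function.Injective fun n => g (u n) := by
    intro m n hmn
    rcases lt_trichotomy m n with hlt | heq | hlt
    · exact (incompatible hlt _ hmn.le le_rfl).elim
    · exact heq
    · exact (incompatible hlt _ hmn.ge le_rfl).elim
  refine Set.infinite_range_of_injective inj (h _ ?_)
  rintro _ ⟨m, rfl⟩ _ ⟨n, rfl⟩ hne ⟨z, hm, hn⟩
  rcases lt_trichotomy m n with hlt | rfl | hlt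
  · exact incompatible hlt z hm hn
  · exact hne rfl
  · exact incompatible hlt z hn hm

/-- Among the strong antichains contained in a given set there is a maximal one, and every element
of the set is compatible with one of its members. -/
theorem exists_isStrongAntichainPO_forall_compatible {α : Type*} [PartialOrder α] (B : Set α) :
    ∃ A ⊆ B, IsStrongAntichainPO A ∧ ∀ t ∈ B, ∃ a ∈ A, ∃ z, t ≤ z ∧ a ≤ z := by
  obtain ⟨A, hA⟩ := zorn_subset {A : Set α | A ⊆ B ∧ IsStrongAntichainPO A} <| by
    intro c hc hchain
    refine ⟨⋃₀ c, ⟨Set.sUnion_subset fun s hs => (hc hs).1, ?_⟩,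
      fun s hs => Set.subset_sUnion_of_mem hs⟩
    rintro x ⟨s, hs, hxs⟩ y ⟨t, ht, hyt⟩
    rcases hchain.total hs ht with hst | hts
    · exact (hc ht).2 x (hst hxs) y hyt
    · exact (hc hs).2 x hxs y (hts hyt)
  refine ⟨A, hA.prop.1, hA.prop.2, fun t ht => ?_⟩
  by_contra! H
  have mem : insert t A ∈ {A : Set α | A ⊆ B ∧ IsStrongAntichainPO A} := by
    refine ⟨Set.insert_subset ht hA.prop.1, ?_⟩
    rintro x (rfl | hx) y (rfl | hy) hne ⟨z, hxz, hyz⟩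
    · exact hne rfl
    · exact H y hy z hxz hyz
    · exact H x hx z hyz hxz
    · exact hA.prop.2 x hx y hy hne ⟨z, hxz, hyz⟩
  have htA : t ∈ A := hA.le_of_ge mem (Set.subset_insert t A) (Set.mem_insert t A)
  exact H t htA t le_rfl le_rfl

/-- If every strong antichain in a partial order is finite, then there is a uniform
finite bound on the size of strong antichains. -/
theorem stmt1 {α : Type*} [PartialOrder α]
    (h : ∀ S : Set α, IsStrongAntichainPO S → S.Finite) :
    ∃ n : ℕ, ∀ S : Finset α, IsStrongAntichainPO (↑S : Set α) → S.card ≤ n := by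
  obtain ⟨A, hAB, hA, hmax⟩ := exists_isStrongAntichainPO_forall_compatible
    {q : α | ∀ x y, q ≤ x → q ≤ y → ∃ z, x ≤ z ∧ y ≤ z}
  have hfin := h A hA
  refine ⟨hfin.toFinset.card, fun S hS => ?_⟩
  have key (s : α) : ∃ a ∈ A, ∃ z, s ≤ z ∧ a ≤ z := by
    obtain ⟨t, hst, ht⟩ := exists_le_forall_compatible h s
    obtain ⟨a, ha, z, htz, haz⟩ := hmax t ht
    exact ⟨a, ha, z, hst.trans htz, haz⟩
  choose a ha w hsw haw using key
  refine Finset.card_le_card_of_injOn a (fun s _ => by simpa using ha s) ?_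
  intro s hs t ht hst
  by_contra hne
  obtain ⟨z, hsz, htz⟩ := hAB (ha s) (w s) (w t) (haw s) (hst ▸ haw t)
  exact hS s hs t ht hne ⟨z, (hsw s).trans hsz, (hsw t).trans htz⟩
end

section
/- If an infinite partial order P is scattered and has no infinite antichains, then the collection of all initial intervals of P has the same cardinality as P. -/
open Cardinal

section InitialIntervals

universe u

variable {α : Type u} [PartialOrder α]

/-- The traces on `Q` of the initial intervals of `α`. -/
def lowerTraces (Q : Set α) : Set (Set α) :=
  {T | ∃ I : Set α, IsLowerSet I ∧ T = I ∩ Q}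

/-- A subset of `α` is small if at most `#α` sets are traces on it of initial intervals. -/
def IsSmallTrace (Q : Set α) : Prop := #(lowerTraces Q) ≤ #α

theorem IsSmallTrace.mono {Q R : Set α} (hR : IsSmallTrace R) (h : Q ⊆ R) : IsSmallTrace Q := by
  have hsub : lowerTraces Q ⊆ (fun T => T ∩ Q) '' lowerTraces R := by
    rintro _ ⟨I, hI, rfl⟩
    refine ⟨I ∩ R, ⟨I, hI, rfl⟩, ?_⟩
    change I ∩ R ∩ Q = I ∩ Q
    rw [Set.inter_assoc, Set.inter_eq_right.2 h]
  exact (mk_le_mk_of_subset hsub).trans (mk_image_le.trans hR)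

variable [Infinite α]

theorem IsSmallTrace.union {Q R : Set α} (hQ : IsSmallTrace Q) (hR : IsSmallTrace R) :
    IsSmallTrace (Q ∪ R) := by
  have hsub : lowerTraces (Q ∪ R) ⊆ Set.image2 (· ∪ ·) (lowerTraces Q) (lowerTraces R) := by
    rintro _ ⟨I, hI, rfl⟩
    exact ⟨I ∩ Q, ⟨I, hI, rfl⟩, I ∩ R, ⟨I, hI, rfl⟩, (Set.inter_union_distrib_left _ _ _).symm⟩
  calc #(lowerTraces (Q ∪ R)) ≤ _ := mk_le_mk_of_subset hsub
    _ ≤ #(lowerTraces Q) * #(lowerTraces R) := mk_image2_le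
    _ ≤ #α * #α := mul_le_mul' hQ hR
    _ = #α := mul_eq_self (aleph0_le_mk α)

omit [PartialOrder α] in
/-- A set of the form `{a} ∪ ⋃ x, F x`, with each `F x` of size at most `#α`, has size at most
`#α`. -/
theorem mk_insert_iUnion_le {β : Type u} (a : β) (F : α → Set β) (hF : ∀ x, #(F x) ≤ #α) :
    #(insert a (⋃ x, F x) : Set β) ≤ #α := by
  have h₁ : #(⋃ x, F x) ≤ #α :=
    (mk_iUnion_le F).trans <| (mul_le_mul' le_rfl (ciSup_le' hF)).trans
      (mul_eq_self (aleph0_le_mk α)).le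
  exact mk_insert_le.trans
    ((add_le_add h₁ (one_le_aleph0.trans (aleph0_le_mk α))).trans
      (add_eq_self (aleph0_le_mk α)).le)

theorem isSmallTrace_of_forall_not_ge {Q : Set α}
    (h : ∀ x ∈ Q, IsSmallTrace {y ∈ Q | ¬ x ≤ y}) : IsSmallTrace Q := by
  classical
  have hsub : lowerTraces Q ⊆
      insert Q (⋃ x, if x ∈ Q then lowerTraces {y ∈ Q | ¬ x ≤ y} else ∅) := by
    rintro _ ⟨I, hI, rfl⟩
    by_cases hQ : Q ⊆ I
    · exact Or.inl (Set.inter_eq_right.2 hQ)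
    · obtain ⟨x, hxQ, hxI⟩ := Set.not_subset.1 hQ
      refine Or.inr (Set.mem_iUnion.2 ⟨x, ?_⟩)
      rw [if_pos hxQ]
      refine ⟨I, hI, ?_⟩
      ext y
      exact ⟨fun hy => ⟨hy.1, hy.2, fun hxy => hxI (hI hxy hy.1)⟩, fun hy => ⟨hy.1, hy.2.1⟩⟩
  refine (mk_le_mk_of_subset hsub).trans (mk_insert_iUnion_le _ _ fun x => ?_)
  split_ifs with hx
  · exact h x hx
  · simp

theorem isSmallTrace_of_forall_not_le {Q : Set α}
    (h : ∀ x ∈ Q, IsSmallTrace {y ∈ Q | ¬ y ≤ x}) : IsSmallTrace Q := by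
  classical
  have hsub : lowerTraces Q ⊆ insert ∅ (⋃ x, if x ∈ Q then
      (fun T => T ∪ (Q ∩ Set.Iic x)) '' lowerTraces {y ∈ Q | ¬ y ≤ x} else ∅) := by
    rintro _ ⟨I, hI, rfl⟩
    rcases (I ∩ Q).eq_empty_or_nonempty with hQ | ⟨x, hxI, hxQ⟩
    · exact Or.inl hQ
    · refine Or.inr (Set.mem_iUnion.2 ⟨x, ?_⟩)
      rw [if_pos hxQ]
      refine ⟨_, ⟨I, hI, rfl⟩, ?_⟩
      ext y
      constructor
      · rintro (hy | hy)
        · exact ⟨hy.1, hy.2.1⟩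
        · exact ⟨hI hy.2 hxI, hy.1⟩
      · intro hy
        by_cases hyx : y ≤ x
        · exact Or.inr ⟨hy.2, hyx⟩
        · exact Or.inl ⟨hy.1, hy.2, hyx⟩
  refine (mk_le_mk_of_subset hsub).trans (mk_insert_iUnion_le _ _ fun x => ?_)
  split_ifs with hx
  · exact mk_image_le.trans (h x hx)
  · simp

/-- In a set that is not small, but in which the elements incomparable to any given one form a
small set, some point has both a lower and an upper part that is not small. -/
theorem exists_not_isSmallTrace_Iio_Ioi {Q : Set α} (hQ : ¬ IsSmallTrace Q)
    (hinc : ∀ x ∈ Q, IsSmallTrace {y ∈ Q | ¬ x ≤ y ∧ ¬ y ≤ x}) :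
    ∃ x ∈ Q, ¬ IsSmallTrace (Q ∩ Set.Iio x) ∧ ¬ IsSmallTrace (Q ∩ Set.Ioi x) := by
  have below : ∀ R ⊆ Q, ¬ IsSmallTrace R → ∃ x ∈ R, ¬ IsSmallTrace (R ∩ Set.Iio x) := by
    intro R hRQ hR
    by_contra! hcon
    refine hR (isSmallTrace_of_forall_not_ge fun x hx =>
      ((hcon x hx).union (hinc x (hRQ hx))).mono ?_)
    rintro y ⟨hy, hxy⟩
    by_cases hyx : y ≤ x
    · exact Or.inl ⟨hy, lt_of_le_not_ge hyx hxy⟩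
    · exact Or.inr ⟨hRQ hy, hxy, hyx⟩
  have above : ∀ R ⊆ Q, ¬ IsSmallTrace R → ∃ x ∈ R, ¬ IsSmallTrace (R ∩ Set.Ioi x) := by
    intro R hRQ hR
    by_contra! hcon
    refine hR (isSmallTrace_of_forall_not_le fun x hx =>
      ((hcon x hx).union (hinc x (hRQ hx))).mono ?_)
    rintro y ⟨hy, hyx⟩
    by_cases hxy : x ≤ y
    · exact Or.inl ⟨hy, lt_of_le_not_ge hxy hyx⟩
    · exact Or.inr ⟨hRQ hy, hxy, hyx⟩
  by_contra! hcon
  have hA : IsSmallTrace {x ∈ Q | ¬ IsSmallTrace (Q ∩ Set.Iio x)} := by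
    by_contra hA
    obtain ⟨x, hx, hx'⟩ := above _ (Set.sep_subset _ _) hA
    exact hx' ((hcon x hx.1 hx.2).mono (Set.inter_subset_inter_left _ (Set.sep_subset _ _)))
  have hB : IsSmallTrace {x ∈ Q | IsSmallTrace (Q ∩ Set.Iio x)} := by
    by_contra hB
    obtain ⟨x, hx, hx'⟩ := below _ (Set.sep_subset _ _) hB
    exact hx' (hx.2.mono (Set.inter_subset_inter_left _ (Set.sep_subset _ _)))
  refine hQ ((hA.union hB).mono fun x hx => ?_)
  by_cases h : IsSmallTrace (Q ∩ Set.Iio x)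
  · exact Or.inr ⟨hx, h⟩
  · exact Or.inl ⟨hx, h⟩

omit [Infinite α] in
theorem exists_not_isSmallTrace_forall_incomparable
    (hac : ∀ D : Set α, IsAntichain (· ≤ ·) D → D.Finite)
    (huniv : ¬ IsSmallTrace (Set.univ : Set α)) :
    ∃ Q : Set α, ¬ IsSmallTrace Q ∧
      ∀ x ∈ Q, IsSmallTrace {y ∈ Q | ¬ x ≤ y ∧ ¬ y ≤ x} := by
  by_contra! hcon
  choose c hcQ hc using hcon
  let step : {Q : Set α // ¬ IsSmallTrace Q} → {Q : Set α // ¬ IsSmallTrace Q} :=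
    fun Q => ⟨_, hc Q.1 Q.2⟩
  let Q : ℕ → {Q : Set α // ¬ IsSmallTrace Q} := fun n => step^[n] ⟨Set.univ, huniv⟩
  have hsucc : ∀ n, Q (n + 1) = step (Q n) := fun n => Function.iterate_succ_apply' _ _ _
  let x : ℕ → α := fun n => c (Q n).1 (Q n).2
  have hanti : Antitone fun n => (Q n).1 := by
    refine antitone_nat_of_succ_le fun n => ?_
    rw [hsucc]
    exact Set.sep_subset _ _
  have hlt : ∀ m n, m < n → ¬ x m ≤ x n ∧ ¬ x n ≤ x m := by
    intro m n hmn
    have h : x n ∈ (Q (m + 1)).1 := hanti (Nat.succ_le_of_lt hmn) (hcQ _ _)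
    rw [hsucc] at h
    exact h.2
  have hinj : Function.Injective x := by
    intro m n hmn
    by_contra hne
    rcases lt_or_gt_of_ne hne with h | h
    · exact (hlt _ _ h).1 hmn.le
    · exact (hlt _ _ h).2 hmn.le
  refine Set.infinite_range_of_injective hinj (hac _ ?_)
  rintro _ ⟨m, rfl⟩ _ ⟨n, rfl⟩ hne
  rcases lt_trichotomy m n with h | h | h
  · exact (hlt _ _ h).1
  · exact absurd (congrArg x h) hne
  · exact (hlt _ _ h).2

omit [Infinite α] in
/-- A nonempty transitive relation that refines `<` and is dense yields a copy of the rationals. -/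
theorem nonempty_rat_orderEmbedding_of_dense (r : α → α → Prop) (hlt : ∀ x y, r x y → x < y)
    (htrans : ∀ x y z, r x y → r y z → r x z) (hdense : ∀ x y, r x y → ∃ z, r x z ∧ r z y)
    {a b : α} (hab : r a b) : Nonempty (ℚ ↪o α) := by
  classical
  obtain ⟨M, hM, habM⟩ := (IsChain.pair (r := r) hab).exists_maxChain
  have hrel : ∀ x ∈ M, ∀ y ∈ M, x < y → r x y := by
    intro x hx y hy hxy
    rcases hM.1 hx hy hxy.ne with h | h
    · exact h
    · exact absurd (hlt _ _ h) hxy.asymm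
  have hchain : IsChain (· ≤ ·) M := fun x hx y hy hne =>
    (hM.1 hx hy hne).imp (fun h => (hlt _ _ h).le) (fun h => (hlt _ _ h).le)
  have hMdense : ∀ x ∈ M, ∀ y ∈ M, x < y → ∃ z ∈ M, x < z ∧ z < y := by
    intro x hx y hy hxy
    by_contra! hcon
    obtain ⟨z, hxz, hzy⟩ := hdense x y (hrel x hx y hy hxy)
    have hins : IsChain r (insert z M) := by
      refine hM.1.insert fun w hw _ => ?_
      rcases eq_or_ne w x with rfl | hwx
      · exact Or.inr hxz
      rcases hM.1 hw hx hwx with h | h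
      · exact Or.inr (htrans _ _ _ h hxz)
      rcases eq_or_ne w y with rfl | hwy
      · exact Or.inl hzy
      rcases hM.1 hw hy hwy with h' | h'
      · exact absurd (hlt _ _ h') (hcon w hw (hlt _ _ h))
      · exact Or.inl (htrans _ _ _ hzy h')
    have hzM : z ∈ M := by
      rw [hM.2 hins (Set.subset_insert _ _)]
      exact Set.mem_insert _ _
    exact hcon z hzM (hlt _ _ hxz) (hlt _ _ hzy)
  let _ : LinearOrder M :=
    { (inferInstance : PartialOrder M) with
      le_total := fun x y => hchain.total x.2 y.2
      toDecidableLE := Classical.decRel _ }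
  have : DenselyOrdered M := ⟨fun x y hxy => by
    obtain ⟨z, hz, h⟩ := hMdense x x.2 y y.2 hxy
    exact ⟨⟨z, hz⟩, h⟩⟩
  have : Nontrivial M :=
    ⟨⟨⟨a, habM (by simp)⟩, ⟨b, habM (by simp)⟩, fun h =>
      (hlt _ _ hab).ne (congrArg Subtype.val h)⟩⟩
  obtain ⟨f⟩ := Order.embedding_from_countable_to_dense ℚ M
  exact ⟨f.trans (OrderEmbedding.subtype M)⟩

theorem isSmallTrace_univ (hscat : IsEmpty (ℚ ↪o α))
    (hac : ∀ D : Set α, IsAntichain (· ≤ ·) D → D.Finite) :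
    IsSmallTrace (Set.univ : Set α) := by
  by_contra huniv
  obtain ⟨Q, hQ, hinc⟩ := exists_not_isSmallTrace_forall_incomparable hac huniv
  have split : ∀ R ⊆ Q, ¬ IsSmallTrace R →
      ∃ x ∈ R, ¬ IsSmallTrace (R ∩ Set.Iio x) ∧ ¬ IsSmallTrace (R ∩ Set.Ioi x) :=
    fun R hRQ hR => exists_not_isSmallTrace_Iio_Ioi hR fun x hx =>
      (hinc x (hRQ hx)).mono fun _ hy => ⟨hRQ hy.1, hy.2⟩
  let r : α → α → Prop := fun x y => x < y ∧ ¬ IsSmallTrace (Q ∩ Set.Ioo x y)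
  obtain ⟨a, -, -, ha⟩ := split Q subset_rfl hQ
  obtain ⟨b, hb, hb', -⟩ := split _ Set.inter_subset_left ha
  have hab : r a b := ⟨hb.2, fun h => hb' (h.mono fun y hy => ⟨hy.1.1, hy.1.2, hy.2⟩)⟩
  refine not_nonempty_iff.2 hscat
    (nonempty_rat_orderEmbedding_of_dense r (fun _ _ h => h.1) ?_ ?_ hab)
  · exact fun x y z hxy hyz => ⟨hxy.1.trans hyz.1, fun h =>
      hxy.2 (h.mono fun w hw => ⟨hw.1, hw.2.1, hw.2.2.trans hyz.1⟩)⟩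
  · intro x y hxy
    obtain ⟨z, hz, hz₁, hz₂⟩ := split _ Set.inter_subset_left hxy.2
    exact ⟨z, ⟨hz.2.1, fun h => hz₁ (h.mono fun w hw => ⟨hw.1.1, hw.1.2.1, hw.2⟩)⟩,
      ⟨hz.2.2, fun h => hz₂ (h.mono fun w hw => ⟨hw.1.1, hw.2, hw.1.2.2⟩)⟩⟩

end InitialIntervals

/-- An infinite scattered partial order with no infinite antichains has exactly as many
initial intervals as elements. -/
theorem stmt3 {α : Type*} [PartialOrder α] [Infinite α]
    (hscat : IsEmpty (ℚ ↪o α))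
    (hac : ∀ D : Set α, IsAntichain (· ≤ ·) D → D.Finite) :
    #{I : Set α // IsLowerSet I} = #α := by
  apply le_antisymm
  · have hsub : {I : Set α | IsLowerSet I} ⊆ lowerTraces Set.univ :=
      fun I hI => ⟨I, hI, (Set.inter_univ I).symm⟩
    exact (mk_le_mk_of_subset hsub).trans (isSmallTrace_univ hscat hac)
  · exact mk_le_of_injective (f := fun x : α => ⟨Set.Iic x, isLowerSet_Iic x⟩)
      fun x y h => Set.Iic_injective (congrArg Subtype.val h)
end

section
/- Let P be a partial order and let (P_x)_{x ∈ P} be a family of partial orders indexed by the elements of P. If P is scattered and each P_x is scattered, then the lexicographic sum Σ_{x ∈ P} P_x — the set of pairs (x, y) with x ∈ P and y ∈ P_x, ordered by (x, y) ≤ (x', y') iff x < x' in P, or x = x' and y ≤ y' in P_x — is scattered. -/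
theorem Sigma.Lex.cast_snd_lt_cast_snd {α : Type*} [Preorder α] {β : α → Type*}
    [∀ x, LT (β x)] {x : α} {a b : Σₗ x, β x} (ha : a.1 = x) (hb : b.1 = x) (h : a < b) :
    (ha ▸ a.2 : β x) < (hb ▸ b.2 : β x) := by
  obtain ⟨i, u⟩ := a
  obtain ⟨j, v⟩ := b
  dsimp only at ha hb
  subst ha
  subst hb
  rcases Sigma.Lex.lt_def.1 h with h | ⟨_, h⟩
  · exact absurd h (lt_irrefl _)
  · exact h

theorem Sigma.Lex.monotone_fst {α : Type*} [Preorder α] {β : α → Type*} [∀ x, LE (β x)]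
    {a b : Σₗ x, β x} (h : a ≤ b) : a.1 ≤ b.1 := by
  rcases Sigma.Lex.le_def.1 h with h | ⟨h, _⟩
  · exact h.le
  · exact h.le

/-- The lexicographic sum of scattered partial orders along a scattered partial order
is scattered. -/
theorem stmt6 {α : Type*} [PartialOrder α] {β : α → Type*} [∀ x, PartialOrder (β x)]
    (hP : IsEmpty (ℚ ↪o α)) (hPx : ∀ x : α, IsEmpty (ℚ ↪o β x)) :
    IsEmpty (ℚ ↪o (Σₗ x, β x)) := by
  refine ⟨fun f => ?_⟩
  have hmono : Monotone fun q => (f q).1 := fun _ _ h =>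
    Sigma.Lex.monotone_fst (f.monotone h)
  by_cases hinj : ∃ q r : ℚ, q < r ∧ (f q).1 = (f r).1
  · obtain ⟨q, r, hqr, heq⟩ := hinj
    have hfst (s : Set.Icc q r) : (f s).1 = (f q).1 :=
      le_antisymm ((hmono s.2.2).trans heq.ge) (hmono s.2.1)
    have : Nontrivial (Set.Icc q r) :=
      ⟨⟨q, le_rfl, hqr.le⟩, ⟨r, hqr.le, le_rfl⟩, fun h => hqr.ne (congrArg Subtype.val h)⟩
    obtain ⟨e⟩ := Order.embedding_from_countable_to_dense ℚ (Set.Icc q r)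
    exact (hPx (f q).1).false <| OrderEmbedding.ofStrictMono
      (fun t => (hfst (e t) ▸ (f (e t)).2 : β (f q).1)) fun _ _ h =>
        Sigma.Lex.cast_snd_lt_cast_snd _ _ (f.strictMono (e.strictMono h))
  · exact hP.false <| OrderEmbedding.ofStrictMono (fun q => (f q).1) fun q r h =>
      (hmono h.le).lt_of_ne fun heq => hinj ⟨q, r, h, heq⟩
end

section
/- Let P be a partial order in which there is a finite upper bound on the sizes of strong antichains, let ℓ be the maximum size of a strong antichain in P, and let S be a strong antichain of size ℓ. Then for each z ∈ S the set A_z = {x ∈ P : x and z have a common upper bound in P} is an ideal of P, and P = ⋃_{z ∈ S} A_z; in particular, P is a finite union of ideals. -/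
/-- Adding an element incompatible with every member of a strong antichain yields a strong
antichain. -/
theorem IsStrongAntichainPO.insert {α : Type*} [PartialOrder α] {S : Set α} {x : α}
    (hS : IsStrongAntichainPO S) (hx : ∀ y ∈ S, ¬ ∃ w, x ≤ w ∧ y ≤ w) :
    IsStrongAntichainPO (insert x S) := by
  rintro a (rfl | ha) b (rfl | hb) hab
  · exact absurd rfl hab
  · exact hx b hb
  · rintro ⟨w, haw, hbw⟩
    exact hx a ha ⟨w, hbw, haw⟩
  · exact hS a ha b hb hab

/-- A subset of a strong antichain is a strong antichain. -/
theorem IsStrongAntichainPO.subset {α : Type*} [PartialOrder α] {S T : Set α}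
    (hS : IsStrongAntichainPO S) (hTS : T ⊆ S) : IsStrongAntichainPO T :=
  fun x hx y hy => hS x (hTS hx) y (hTS hy)

/-- If `ℓ` is the maximum size of a strong antichain in `P` and `S` is a strong
antichain of size `ℓ`, then the sets `A_z = {x : x and z are compatible}` for `z ∈ S`
are ideals covering `P`. -/
theorem stmt8 {α : Type*} [PartialOrder α] (ℓ : ℕ) (S : Finset α)
    (hS : IsStrongAntichainPO (↑S : Set α)) (hcard : S.card = ℓ)
    (hmax : ∀ T : Finset α, IsStrongAntichainPO (↑T : Set α) → T.card ≤ ℓ) :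
    (∀ z ∈ S, IsIdealPO {x : α | ∃ w, x ≤ w ∧ z ≤ w}) ∧
      (⋃ z ∈ S, {x : α | ∃ w, x ≤ w ∧ z ≤ w}) = (Set.univ : Set α) := by
  classical
  subst hcard
  have notMem {T : Finset α} {x : α} (hx : ∀ y ∈ T, ¬ ∃ w, x ≤ w ∧ y ≤ w) : x ∉ T :=
    fun h => hx x h ⟨x, le_rfl, le_rfl⟩
  refine ⟨fun z hz => ⟨fun a b hba ⟨w, haw, hzw⟩ => ⟨w, hba.trans haw, hzw⟩, ?_⟩, ?_⟩
  · rintro x ⟨u, hxu, hzu⟩ y ⟨v, hyv, hzv⟩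
    by_cases huv : ∃ w, u ≤ w ∧ v ≤ w
    · obtain ⟨w, huw, hvw⟩ := huv
      exact ⟨w, ⟨w, le_rfl, hzu.trans huw⟩, hxu.trans huw, hyv.trans hvw⟩
    exfalso
    have above {t : α} (hzt : z ≤ t) : ∀ s ∈ S.erase z, ¬ ∃ w, t ≤ w ∧ s ≤ w := by
      rintro s hs ⟨w, htw, hsw⟩
      exact hS z hz s (Finset.mem_of_mem_erase hs) (Finset.ne_of_mem_erase hs).symm
        ⟨w, hzt.trans htw, hsw⟩
    have hu : ∀ s ∈ insert v (S.erase z), ¬ ∃ w, u ≤ w ∧ s ≤ w := by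
      intro s hs
      rcases Finset.mem_insert.mp hs with rfl | hs
      · exact huv
      · exact above hzu s hs
    have hE : IsStrongAntichainPO (↑(S.erase z) : Set α) :=
      hS.subset (Finset.coe_subset.mpr (S.erase_subset z))
    have hV : IsStrongAntichainPO (↑(insert v (S.erase z)) : Set α) := by
      rw [Finset.coe_insert]
      exact hE.insert (above hzv)
    have hle := hmax (insert u (insert v (S.erase z))) (by
      rw [Finset.coe_insert]
      exact hV.insert hu)
    rw [Finset.card_insert_of_notMem (notMem hu),
      Finset.card_insert_of_notMem (notMem (above hzv)), Finset.card_erase_add_one hz] at hle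
    omega
  · refine Set.eq_univ_of_forall fun x => ?_
    by_contra hx
    have hinc : ∀ z ∈ S, ¬ ∃ w, x ≤ w ∧ z ≤ w :=
      fun z hz h => hx (Set.mem_biUnion (Finset.mem_coe.mpr hz) h)
    have hle := hmax (insert x S) (by
      rw [Finset.coe_insert]
      exact hS.insert hinc)
    rw [Finset.card_insert_of_notMem (notMem hinc)] at hle
    omega
end

section
/- Let P be a countable partial order whose collection of initial intervals is uncountable. Then there exists x ∈ P such that either (i) the set inc(x) = {y ∈ P : y is incomparable to x}, equipped with the order induced from P, has uncountably many initial intervals, or (ii) both the strict lower cone {y ∈ P : y < x} and the strict upper cone {y ∈ P : x < y}, each equipped with the induced order, have uncountably many initial intervals. -/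
/-- The preimage of a lower set in a subtype is a lower set. -/
theorem IsLowerSet.preimage_subtypeVal {α : Type*} [PartialOrder α] {I : Set α}
    (hI : IsLowerSet I) (p : α → Prop) :
    IsLowerSet ((Subtype.val : {y : α // p y} → α) ⁻¹' I) :=
  fun _ _ hba ha => hI hba ha

/-- A family of lower sets is countable if its members are determined by their traces on two
subsets, each of which has only countably many lower sets. -/
theorem countable_of_lowerSet_traces {α : Type*} [PartialOrder α] {p q : α → Prop}
    {F : Set (Set α)} (hF : ∀ I ∈ F, IsLowerSet I)
    (hp : {I : Set {y : α // p y} | IsLowerSet I}.Countable)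
    (hq : {I : Set {y : α // q y} | IsLowerSet I}.Countable)
    (hdet : ∀ I ∈ F, ∀ J ∈ F, ∀ y, ¬ p y → ¬ q y → (y ∈ I ↔ y ∈ J)) :
    F.Countable := by
  refine Set.MapsTo.countable_of_injOn
    (f := fun I => ((Subtype.val : {y : α // p y} → α) ⁻¹' I,
      (Subtype.val : {y : α // q y} → α) ⁻¹' I))
    (fun I hI => ?_) (fun I hI J hJ hIJ => ?_) (hp.prod hq)
  · exact ⟨(hF I hI).preimage_subtypeVal p, (hF I hI).preimage_subtypeVal q⟩
  · obtain ⟨h₁, h₂⟩ := Prod.mk.inj hIJ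
    ext y
    by_cases hpy : p y
    · exact Set.ext_iff.1 h₁ ⟨y, hpy⟩
    by_cases hqy : q y
    · exact Set.ext_iff.1 h₂ ⟨y, hqy⟩
    exact hdet I hI J hJ y hpy hqy

/-- If a countable partial order has uncountably many initial intervals, then there is
some `x` such that either the set of elements incomparable with `x` has uncountably many
initial intervals, or both the strict lower and strict upper cones of `x` have
uncountably many initial intervals. -/
theorem stmt10 {α : Type*} [PartialOrder α] [Countable α]
    (h : ¬ {I : Set α | IsLowerSet I}.Countable) :
    ∃ x : α,
      (¬ {I : Set {y : α // ¬ y ≤ x ∧ ¬ x ≤ y} | IsLowerSet I}.Countable) ∨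
      ((¬ {I : Set {y : α // y < x} | IsLowerSet I}.Countable) ∧
       (¬ {I : Set {y : α // x < y} | IsLowerSet I}.Countable)) := by
  by_contra hne
  have hinc (x : α) : {I : Set {y : α // ¬ y ≤ x ∧ ¬ x ≤ y} | IsLowerSet I}.Countable := by
    by_contra hx
    exact hne ⟨x, Or.inl hx⟩
  have hcone (x : α) (hx : ¬ {I : Set {y : α // y < x} | IsLowerSet I}.Countable) :
      {I : Set {y : α // x < y} | IsLowerSet I}.Countable := by
    by_contra hx'
    exact hne ⟨x, Or.inr ⟨hx, hx'⟩⟩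
  let A : Set α := {x | {I : Set {y : α // y < x} | IsLowerSet I}.Countable}
  have hA (x : α) (hx : x ∈ A) : {I : Set α | IsLowerSet I ∧ x ∉ I}.Countable := by
    refine countable_of_lowerSet_traces (fun I hI => hI.1) (hinc x) hx ?_
    intro I hI J hJ y hy hlt
    have hxy : x ≤ y := by
      by_contra hxy
      exact hy ⟨fun hyx => hlt (lt_of_le_not_ge hyx hxy), hxy⟩
    exact iff_of_false (fun hyI => hI.2 (hI.1 hxy hyI)) (fun hyJ => hJ.2 (hJ.1 hxy hyJ))
  have hB (x : α) (hx : x ∉ A) : {I : Set α | IsLowerSet I ∧ x ∈ I}.Countable := by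
    refine countable_of_lowerSet_traces (fun I hI => hI.1) (hinc x) (hcone x hx) ?_
    intro I hI J hJ y hy hlt
    have hyx : y ≤ x := by
      by_contra hyx
      exact hy ⟨hyx, fun hxy => hlt (lt_of_le_not_ge hxy hyx)⟩
    exact iff_of_true (hI.1 hyx hI.2) (hJ.1 hyx hJ.2)
  refine h (((Set.countable_iUnion fun x : A => hA x x.2).union
    (Set.countable_iUnion fun x : (Aᶜ : Set α) => hB x x.2)).union
    (Set.countable_singleton A) |>.mono fun I hI => ?_)
  by_cases h₁ : ∃ x ∈ A, x ∉ I
  · obtain ⟨x, hx, hxI⟩ := h₁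
    exact Or.inl (Or.inl (Set.mem_iUnion.2 ⟨⟨x, hx⟩, hI, hxI⟩))
  by_cases h₂ : ∃ x ∉ A, x ∈ I
  · obtain ⟨x, hx, hxI⟩ := h₂
    exact Or.inl (Or.inr (Set.mem_iUnion.2 ⟨⟨x, hx⟩, hI, hxI⟩))
  push Not at h₁ h₂
  exact Or.inr (Set.Subset.antisymm (fun x hx => by_contra fun hxA => h₂ x hxA hx) h₁)
end

section
/- For every countable partial order P, the collection of initial intervals of P is either countable or has cardinality 2^{ℵ₀} (the cardinality of the continuum). -/
open Cardinal

/-- The Boolean-valued antitone functions form a closed subset of the Cantor-type space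
`α → Bool`. -/
theorem isClosed_setOf_isLowerSet_preimage_true {α : Type*} [LE α] :
    IsClosed {f : α → Bool | IsLowerSet {x | f x = true}} := by
  simp only [IsLowerSet, Set.mem_ofPred_eq, Set.ofPred_forall]
  refine isClosed_iInter fun x => isClosed_iInter fun y => isClosed_iInter fun _ => ?_
  have h : IsClosed ((fun f : α → Bool => (f x, f y)) ⁻¹' {p | p.1 = true → p.2 = true}) :=
    (isClosed_discrete _).preimage ((continuous_apply x).prodMk (continuous_apply y))
  exact h

/-- The collection of initial intervals of a countable partial order is either countable
or of cardinality continuum. -/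
theorem stmt11 {α : Type*} [PartialOrder α] [Countable α] :
    {I : Set α | IsLowerSet I}.Countable ∨
      #{I : Set α // IsLowerSet I} = Cardinal.continuum := by
  classical
  have : PolishSpace Bool := inferInstance
  refine or_iff_not_imp_left.mpr fun hunc => le_antisymm ?_ ?_
  · calc #{I : Set α // IsLowerSet I} ≤ #(Set α) := mk_subtype_le _
      _ = 2 ^ #α := mk_set
      _ ≤ 2 ^ ℵ₀ := power_le_power_left two_ne_zero mk_le_aleph0
      _ = continuum := two_power_aleph0
  · have hC : ¬ {f : α → Bool | IsLowerSet {x | f x = true}}.Countable := fun h => by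
      refine hunc ((h.image fun f => {x | f x = true}).mono fun I hI => ?_)
      exact ⟨fun x => decide (x ∈ I), by simpa using hI, by simp⟩
    obtain ⟨g, hg, -, hinj⟩ :=
      isClosed_setOf_isLowerSet_preimage_true.exists_nat_bool_injection_of_not_countable hC
    let F : (ℕ → Bool) → {I : Set α // IsLowerSet I} :=
      fun s => ⟨{x | g s x = true}, hg ⟨s, rfl⟩⟩
    have hF : Function.Injective F := fun s t hst => hinj <| funext fun x =>
      Bool.eq_iff_iff.mpr (Set.ext_iff.mp (congrArg Subtype.val hst) x)
    simpa using lift_mk_le_lift_mk_of_injective hF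
end

section
/- If a countable partial order P is not scattered (i.e., the rationals ℚ order-embed into P), then the collection of initial intervals of P has cardinality 2^{ℵ₀} (the cardinality of the continuum). -/
open Cardinal

/-- The lower set generated by the image under `f` of the rationals below a real number. -/
def lowerCut {α : Type*} [Preorder α] (f : ℚ ↪o α) (r : ℝ) : {I : Set α // IsLowerSet I} :=
  ⟨{x | ∃ q : ℚ, (q : ℝ) < r ∧ x ≤ f q}, fun _ _ hba ⟨q, hq, ha⟩ => ⟨q, hq, hba.trans ha⟩⟩

theorem apply_mem_lowerCut {α : Type*} [Preorder α] (f : ℚ ↪o α) (r : ℝ) (p : ℚ) :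
    f p ∈ (lowerCut f r).1 ↔ (p : ℝ) < r := by
  refine ⟨fun ⟨q, hq, h⟩ => lt_of_le_of_lt ?_ hq, fun h => ⟨p, h, le_rfl⟩⟩
  exact_mod_cast f.le_iff_le.1 h

theorem lowerCut_injective {α : Type*} [Preorder α] (f : ℚ ↪o α) :
    Function.Injective (lowerCut f) := by
  intro r s h
  refine eq_of_forall_rat_lt_iff_lt fun q => ?_
  rw [← apply_mem_lowerCut f, ← apply_mem_lowerCut f, h]

/-- A countable non-scattered partial order has continuum many initial intervals. -/
theorem stmt12 {α : Type*} [PartialOrder α] [Countable α]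
    (h : Nonempty (ℚ ↪o α)) :
    #{I : Set α // IsLowerSet I} = Cardinal.continuum := by
  obtain ⟨f⟩ := h
  apply le_antisymm
  · calc #{I : Set α // IsLowerSet I} ≤ #(Set α) := mk_subtype_le _
      _ = 2 ^ #α := mk_set
      _ ≤ 2 ^ ℵ₀ := power_le_power_left two_ne_zero mk_le_aleph0
      _ = 𝔠 := two_power_aleph0
  · simpa [mk_real] using lift_mk_le_lift_mk_of_injective (lowerCut_injective f)
end

section
/- Let P be a partial order and let D ⊆ P be an infinite antichain that is maximal with respect to inclusion. Then the downward closure I = {x ∈ P : ∃ d ∈ D, x ≤ d} is an initial interval of P that is not a finite union of ideals. -/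
/-- An ideal contained in the downward closure of an antichain meets that antichain in at most
one point. -/
theorem IsIdealPO.subsingleton_inter_of_isAntichain {α : Type*} [PartialOrder α] {A D : Set α}
    (hA : IsIdealPO A) (hD : IsAntichain (· ≤ ·) D) (hAD : ∀ x ∈ A, ∃ d ∈ D, x ≤ d) :
    (A ∩ D).Subsingleton := by
  rintro x ⟨hxA, hxD⟩ y ⟨hyA, hyD⟩
  obtain ⟨z, hzA, hxz, hyz⟩ := hA.2 x hxA y hyA
  obtain ⟨d, hd, hzd⟩ := hAD z hzA
  exact (hD.eq hxD hd (hxz.trans hzd)).trans (hD.eq hyD hd (hyz.trans hzd)).symm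

/-- The downward closure of a maximal infinite antichain is an initial interval which
is not a finite union of ideals. -/
theorem stmt14 {α : Type*} [PartialOrder α] (D : Set α)
    (hD : IsAntichain (· ≤ ·) D) (hinf : D.Infinite)
    (hmax : ∀ E : Set α, IsAntichain (· ≤ ·) E → D ⊆ E → E = D) :
    IsLowerSet {x : α | ∃ d ∈ D, x ≤ d} ∧
      ¬ ∃ F : Finset (Set α), (∀ A ∈ F, IsIdealPO A) ∧
          {x : α | ∃ d ∈ D, x ≤ d} = ⋃₀ ↑F := by
  refine ⟨fun x y hyx ⟨d, hd, hxd⟩ => ⟨d, hd, hyx.trans hxd⟩, ?_⟩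
  rintro ⟨F, hF, hU⟩
  refine hinf ((F.finite_toSet.biUnion (t := fun A => A ∩ D) fun A hA => ?_).subset ?_)
  · refine ((hF A hA).subsingleton_inter_of_isAntichain hD fun x hx => ?_).finite
    exact hU.symm.subset (Set.mem_sUnion_of_mem hx hA)
  · intro d hd
    obtain ⟨A, hA, hdA⟩ := hU.subset ⟨d, hd, le_rfl⟩
    exact Set.mem_biUnion hA ⟨hdA, hd⟩
end

section
/- There exists a partial order ≤ on ℕ whose order relation is computable (i.e., the function ℕ × ℕ → Bool deciding x ≤ y is computable) such that: (i) there is an infinite set D ⊆ ℕ with computable characteristic function whose elements are pairwise incomparable (an infinite computable antichain); and (ii) every initial interval I ⊆ ℕ of this partial order whose characteristic function is computable is the downward closure of a finite set, i.e., there is a finite F ⊆ ℕ with I = {x : ∃ y ∈ F, x ≤ y}. -/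
namespace AntichainPoset

open Nat.Partrec (Code)
open Nat.Partrec.Code

/-- Given the stacks `H` of all earlier stages, the value at stage `s` of the witness `v`, computed
by the code whose index is the height at which `v` is put on the stack. -/
def histVal (H : List (List ℕ)) (s v : ℕ) : Option ℕ :=
  evaln s (Denumerable.ofNat Code (H.getD v []).length) v

/-- The next stack: all even `u` such that no member of the stack at stage `u` has received its
value since stage `u`. -/
def nextStack (H : List (List ℕ)) : List ℕ :=
  (List.range H.length).filter fun u =>
    decide (u % 2 = 0 ∧ ∀ v ∈ H.getD u [], histVal H H.length v = histVal H u v)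

/-- The list of the stacks at stages before `n`. -/
def hist (n : ℕ) : List (List ℕ) :=
  Nat.rec [] (fun _ H => H ++ [nextStack H]) n

/-- The stack of active witnesses at stage `n`. -/
def stack (n : ℕ) : List ℕ := nextStack (hist n)

/-- The value at stage `s` of the witness `v`. -/
def val (s v : ℕ) : Option ℕ :=
  evaln s (Denumerable.ofNat Code (stack v).length) v

/-- The order: `x` lies below a later `y` when `x` is active with value `0` at stage `y`, and
above it when it is active with value `1`. -/
def rel (x y : ℕ) : Bool :=
  decide (x = y ∨ (x ∈ stack y ∧ val y x = some 0) ∨ (y ∈ stack x ∧ val x y = some 1))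

section Computability

open Primrec

theorem primrec_histVal :
    Primrec fun a : List (List ℕ) × ℕ × ℕ => histVal a.1 a.2.1 a.2.2 :=
  primrec_evaln.comp <| .pair
    (.pair (fst.comp snd) ((Primrec.ofNat Code).comp
      (list_length.comp ((list_getD []).comp fst (snd.comp snd)))))
    (snd.comp snd)

theorem primrec_nextStack : Primrec nextStack := by
  have h : PrimrecRel fun (v : ℕ) (b : List (List ℕ) × ℕ) =>
      histVal b.1 b.1.length v = histVal b.1 b.2 v :=
    Primrec.eq.comp
      (primrec_histVal.comp (.pair (fst.comp snd)
        (.pair (list_length.comp (fst.comp snd)) fst)))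
      (primrec_histVal.comp (.pair (fst.comp snd) (.pair (snd.comp snd) fst)))
  have h' : PrimrecRel fun (u : ℕ) (H : List (List ℕ)) =>
      u % 2 = 0 ∧ ∀ v ∈ H.getD u [], histVal H H.length v = histVal H u v :=
    (Primrec.eq.comp (nat_mod.comp fst (const 2)) (const 0)).and
      (h.forall_mem_list.comp ((list_getD []).comp snd fst) (.pair snd fst))
  exact h'.listFilter.comp (list_range.comp list_length) .id

theorem primrec_hist : Primrec hist :=
  nat_rec₁ [] (list_concat.comp snd (primrec_nextStack.comp snd)).to₂

theorem primrec_stack : Primrec stack := primrec_nextStack.comp primrec_hist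

theorem primrec_val : Primrec₂ val :=
  primrec_evaln.comp <| .pair
    (.pair fst ((Primrec.ofNat Code).comp (list_length.comp (primrec_stack.comp snd)))) snd

theorem primrec_mem : PrimrecRel fun (x : ℕ) (l : List ℕ) => x ∈ l := by
  have h : PrimrecRel fun (l : List ℕ) (x : ℕ) => ∃ a ∈ l, a = x :=
    PrimrecRel.exists_mem_list Primrec.eq
  exact (h.comp snd fst).of_eq fun a => by simp

theorem primrec_rel : Primrec₂ rel := by
  have h : PrimrecPred fun a : ℕ × ℕ => a.1 = a.2 ∨ (a.1 ∈ stack a.2 ∧ val a.2 a.1 = some 0) ∨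
      (a.2 ∈ stack a.1 ∧ val a.1 a.2 = some 1) :=
    (Primrec.eq.comp fst snd).or
      (((primrec_mem.comp fst (primrec_stack.comp snd)).and
          (Primrec.eq.comp (primrec_val.comp snd fst) (const (some 0)))).or
        ((primrec_mem.comp snd (primrec_stack.comp fst)).and
          (Primrec.eq.comp (primrec_val.comp fst snd) (const (some 1)))))
  exact h.decide

end Computability

theorem hist_eq_map (n : ℕ) : hist n = (List.range n).map stack := by
  induction n with
  | zero => rfl
  | succ n ih => rw [List.range_succ, List.map_append, ← ih]; rfl

theorem mem_stack_iff {u s : ℕ} :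
    u ∈ stack s ↔ u < s ∧ u % 2 = 0 ∧ ∀ v ∈ stack u, val s v = val u v := by
  have hlt : ∀ {v w}, v ∈ stack w → v < w := by
    intro v w h
    have := List.mem_of_mem_filter h
    simpa [hist_eq_map] using this
  have hget : ∀ {v}, v < s → (hist s).getD v [] = stack v := by
    intro v h
    simp [hist_eq_map, h]
  have hlen : (hist s).length = s := by simp [hist_eq_map]
  rw [stack, nextStack, List.mem_filter, List.mem_range, hlen, decide_eq_true_iff]
  refine and_congr_right fun hu => and_congr_right fun _ => ?_
  rw [hget hu]
  refine forall₂_congr fun v hv => ?_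
  rw [histVal, histVal, hget ((hlt hv).trans hu), val, val]

theorem lt_of_mem_stack {u s : ℕ} (h : u ∈ stack s) : u < s := (mem_stack_iff.1 h).1

theorem val_mono {s t v a : ℕ} (hst : s ≤ t) (h : val s v = some a) : val t v = some a :=
  evaln_mono hst h

theorem val_eq_of_le_of_le {s t u v : ℕ} (hst : s ≤ t) (htu : t ≤ u) (h : val u v = val s v) :
    val t v = val s v := by
  cases hs : val s v with
  | some a => exact val_mono hst hs
  | none =>
    cases ht : val t v with
    | none => rfl
    | some a => simp [hs, val_mono htu ht] at h

theorem mem_stack_of_le {u s t : ℕ} (h : u ∈ stack t) (hus : u < s) (hst : s ≤ t) :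
    u ∈ stack s := by
  rw [mem_stack_iff] at h ⊢
  exact ⟨hus, h.2.1, fun v hv => val_eq_of_le_of_le hus.le hst (h.2.2 v hv)⟩

theorem mem_stack_trans {u v w : ℕ} (huv : u ∈ stack v) (hvw : v ∈ stack w) : u ∈ stack w := by
  induction u using Nat.strong_induction_on generalizing v w with
  | _ u ih =>
    have hv := mem_stack_iff.1 huv
    have hw := mem_stack_iff.1 hvw
    refine mem_stack_iff.2 ⟨hv.1.trans hw.1, hv.2.1, fun x hx => ?_⟩
    rw [hw.2.2 x (ih x (lt_of_mem_stack hx) hx huv), hv.2.2 x hx]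

/-- Two members of a stack were already in the same position when the later one was put there. -/
theorem mem_stack_and_val_eq {u v s : ℕ} (huv : u < v) (hu : u ∈ stack s) (hv : v ∈ stack s) :
    u ∈ stack v ∧ val v u = val s u := by
  have h := mem_stack_of_le hu huv (lt_of_mem_stack hv).le
  exact ⟨h, ((mem_stack_iff.1 hv).2.2 u h).symm⟩

theorem rel_iff {x y : ℕ} : rel x y = true ↔
    x = y ∨ (x ∈ stack y ∧ val y x = some 0) ∨ (y ∈ stack x ∧ val x y = some 1) := by
  simp [rel]

theorem val_ne_of_val_eq {s t v : ℕ} (hs : val s v = some 0) (ht : val t v = some 1) : False := by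
  rcases le_total s t with h | h
  · simp [val_mono h hs] at ht
  · simp [val_mono h ht] at hs

theorem rel_antisymm {x y : ℕ} (hxy : rel x y = true) (hyx : rel y x = true) : x = y := by
  rw [rel_iff] at hxy hyx
  rcases hxy with h | ⟨h, h'⟩ | ⟨h, h'⟩
  · exact h
  · rcases hyx with k | ⟨k, k'⟩ | ⟨k, k'⟩
    · exact k.symm
    · exact absurd (lt_of_mem_stack h) (lt_of_mem_stack k).le.not_gt
    · exact (val_ne_of_val_eq h' k').elim
  · rcases hyx with k | ⟨k, k'⟩ | ⟨k, k'⟩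
    · exact k.symm
    · exact (val_ne_of_val_eq k' h').elim
    · exact absurd (lt_of_mem_stack h) (lt_of_mem_stack k).le.not_gt

theorem rel_trans {x y z : ℕ} (hxy : rel x y = true) (hyz : rel y z = true) :
    rel x z = true := by
  rw [rel_iff] at *
  rcases hxy with rfl | ⟨h, h'⟩ | ⟨h, h'⟩
  · exact hyz
  · rcases hyz with rfl | ⟨k, k'⟩ | ⟨k, k'⟩
    · exact .inr (.inl ⟨h, h'⟩)
    · exact .inr (.inl ⟨mem_stack_trans h k, val_mono (lt_of_mem_stack k).le h'⟩)
    · rcases lt_trichotomy x z with hxz | rfl | hxz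
      · obtain ⟨m, e⟩ := mem_stack_and_val_eq hxz h k
        exact .inr (.inl ⟨m, e.trans h'⟩)
      · exact .inl rfl
      · obtain ⟨m, e⟩ := mem_stack_and_val_eq hxz k h
        exact .inr (.inr ⟨m, e.trans k'⟩)
  · rcases hyz with rfl | ⟨k, k'⟩ | ⟨k, k'⟩
    · exact .inr (.inr ⟨h, h'⟩)
    · exact (val_ne_of_val_eq k' h').elim
    · exact .inr (.inr ⟨mem_stack_trans k h, val_mono (lt_of_mem_stack h).le k'⟩)

theorem rel_eq_false_of_odd {x y : ℕ} (hx : x % 2 = 1) (hy : y % 2 = 1) (hxy : x ≠ y) :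
    rel x y = false := by
  rw [← Bool.not_eq_true, rel_iff]
  rintro (h | ⟨h, -⟩ | ⟨h, -⟩)
  · exact hxy h
  · have := (mem_stack_iff.1 h).2.1
    omega
  · have := (mem_stack_iff.1 h).2.1
    omega

/-- Elements which are never removed from the stack. -/
def Permanent (t : ℕ) : Prop := ∀ s, t < s → t ∈ stack s

theorem exists_val_eventually_const (v : ℕ) : ∃ M, ∀ s ≥ M, val s v = val M v := by
  by_cases h : ∃ M a, val M v = some a
  · obtain ⟨M, a, ha⟩ := h
    exact ⟨M, fun s hs => by rw [ha, val_mono hs ha]⟩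
  · push Not at h
    exact ⟨0, fun s _ => by rw [Option.eq_none_iff_forall_ne_some.2 (h s),
      Option.eq_none_iff_forall_ne_some.2 (h 0)]⟩

theorem exists_permanent_ge (N : ℕ) : ∃ t ≥ N, Permanent t := by
  choose M hM using exists_val_eventually_const
  obtain ⟨B, hB⟩ : ∃ B, ∀ v < N, M v ≤ B :=
    ⟨(Finset.range N).sup M, fun v hv => Finset.le_sup (Finset.mem_range.2 hv)⟩
  have hconst : ∀ v < N, ∀ s ≥ B, ∀ s' ≥ B, val s v = val s' v := fun v hv s hs s' hs' => by
    rw [hM v s ((hB v hv).trans hs), hM v s' ((hB v hv).trans hs')]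
  obtain ⟨t, htN, htB, ht2⟩ : ∃ t, N ≤ t ∧ B ≤ t ∧ t % 2 = 0 :=
    ⟨2 * (N + B), by omega, by omega, by omega⟩
  have hex : ∃ v, N ≤ v ∧ (v = t ∨ v ∈ stack t) := ⟨t, htN, .inl rfl⟩
  classical
  obtain ⟨hvN, hv⟩ := Nat.find_spec hex
  have hmin := fun w => Nat.find_min (m := w) hex
  generalize Nat.find hex = v at *
  have hsub : ∀ x ∈ stack v, x < N := fun x hx => by
    by_contra! hxN
    refine hmin x (lt_of_mem_stack hx) ⟨hxN, .inr ?_⟩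
    rcases hv with rfl | hv
    · exact hx
    · exact mem_stack_trans hx hv
  have hval : v % 2 = 0 ∧ v ≤ t ∧ ∀ x ∈ stack v, val t x = val v x := by
    rcases hv with rfl | hv
    · exact ⟨ht2, le_rfl, fun _ _ => rfl⟩
    · have := mem_stack_iff.1 hv
      exact ⟨this.2.1, this.1.le, this.2.2⟩
  have hlate : ∀ s, v < s → t ≤ s → v ∈ stack s := fun s hvs hts =>
    mem_stack_iff.2 ⟨hvs, hval.1, fun x hx => by
      rw [hconst x (hsub x hx) s (htB.trans hts) t htB, hval.2.2 x hx]⟩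
  refine ⟨v, hvN, fun s hvs => ?_⟩
  exact mem_stack_of_le (hlate (s + t) (by omega) (by omega)) hvs (by omega)

theorem Permanent.mem_stack_iff {u t : ℕ} (ht : Permanent t) :
    u ∈ stack t ↔ u < t ∧ Permanent u := by
  refine ⟨fun h => ⟨lt_of_mem_stack h, fun s hs => ?_⟩, fun h => h.2 t h.1⟩
  exact mem_stack_of_le (mem_stack_trans h (ht (s + t + 1) (by omega))) hs (by omega)

theorem Permanent.length_stack [DecidablePred Permanent] {t : ℕ} (ht : Permanent t) :
    (stack t).length = Nat.count Permanent t := by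
  have h : stack t = (List.range t).filter fun u => decide (Permanent u) := by
    have hlen : (hist t).length = t := by simp [hist_eq_map]
    rw [stack, nextStack, hlen]
    refine List.filter_congr fun u hu => ?_
    have hu' := List.mem_range.1 hu
    have := ht.mem_stack_iff (u := u)
    rw [stack, nextStack, List.mem_filter, hlen, and_iff_right hu, and_iff_right hu'] at this
    rw [Bool.eq_iff_iff, this, decide_eq_true_iff]
  rw [h, Nat.count, List.countP_eq_length_filter]

theorem exists_permanent_length_eq (e : ℕ) : ∃ t, Permanent t ∧ (stack t).length = e := by
  classical
  have hinf : {t | Permanent t}.Infinite :=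
    Set.infinite_of_forall_exists_gt fun N => by
      obtain ⟨t, ht, hp⟩ := exists_permanent_ge (N + 1)
      exact ⟨t, hp, ht⟩
  have hp := Nat.nth_mem_of_infinite hinf e
  exact ⟨_, hp, by rw [hp.length_stack, Nat.count_nth_of_infinite hinf]⟩

/-- Every computable set has a permanent witness whose value is eventually its characteristic
function. -/
theorem exists_permanent_val_eq {χ : ℕ → Bool} (hχ : Computable χ) :
    ∃ t s₀, Permanent t ∧ ∀ s ≥ s₀, val s t = some (χ t).toNat := by
  have hf : Nat.Partrec fun n => Part.some (χ n).toNat := by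
    have h : Computable fun n => (χ n).toNat :=
      (Computable.cond hχ (.const 1) (.const 0)).of_eq fun n => by cases χ n <;> rfl
    exact Partrec.nat_iff.1 h
  obtain ⟨c, hc⟩ := exists_code.1 hf
  obtain ⟨t, ht, hlen⟩ := exists_permanent_length_eq (Encodable.encode c)
  have hmem : (χ t).toNat ∈ eval c t := by rw [hc]; exact Part.mem_some _
  obtain ⟨k, hk⟩ := evaln_complete.1 hmem
  refine ⟨t, k, ht, fun s hs => val_mono hs ?_⟩
  rw [val, hlen, Denumerable.ofNat_encode]
  exact hk

theorem exists_finset_generating {I : Set ℕ} (hI : ∀ x y, rel x y = true → y ∈ I → x ∈ I)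
    {χ : ℕ → Bool} (hχ : Computable χ) (hIχ : ∀ n, n ∈ I ↔ χ n = true) :
    ∃ F : Finset ℕ, I = {x : ℕ | ∃ y ∈ F, rel x y = true} := by
  classical
  obtain ⟨t, s₀, ht, hval⟩ := exists_permanent_val_eq hχ
  refine ⟨(Finset.range (t + s₀ + 1)).filter (· ∈ I), Set.ext fun x => ⟨fun hx => ?_, ?_⟩⟩
  · by_cases hxs : x < t + s₀ + 1
    · exact ⟨x, by simp [hxs, hx], rel_iff.2 (.inl rfl)⟩
    · have hmem := ht x (by omega)
      have hv := hval x (by omega)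
      cases hχt : χ t with
      | true =>
        exact ⟨t, by simp [(hIχ t).2 hχt],
          rel_iff.2 (.inr (.inr ⟨hmem, by simpa [hχt] using hv⟩))⟩
      | false =>
        have := hI t x (rel_iff.2 (.inr (.inl ⟨hmem, by simpa [hχt] using hv⟩))) hx
        simp [hIχ, hχt] at this
  · rintro ⟨y, hy, hxy⟩
    exact hI x y hxy (Finset.mem_filter.1 hy).2

end AntichainPoset


/-- There is a computable partial order on `ℕ` with an infinite computable antichain in
which every computable initial interval is the downward closure of a finite set. -/
theorem stmt19 :
    ∃ r : ℕ → ℕ → Bool,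
      Computable₂ r ∧
      (∀ x, r x x = true) ∧
      (∀ x y, r x y = true → r y x = true → x = y) ∧
      (∀ x y z, r x y = true → r y z = true → r x z = true) ∧
      (∃ χ : ℕ → Bool, Computable χ ∧ {n : ℕ | χ n = true}.Infinite ∧
        ∀ x y, χ x = true → χ y = true → x ≠ y → r x y = false) ∧
      (∀ I : Set ℕ,
        (∀ x y, r x y = true → y ∈ I → x ∈ I) →
        (∃ χ : ℕ → Bool, Computable χ ∧ ∀ n, n ∈ I ↔ χ n = true) →
        ∃ F : Finset ℕ, I = {x : ℕ | ∃ y ∈ F, r x y = true}) := by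
  refine ⟨AntichainPoset.rel, AntichainPoset.primrec_rel.to_comp,
    fun x => AntichainPoset.rel_iff.2 (.inl rfl), fun _ _ => AntichainPoset.rel_antisymm,
    fun _ _ _ => AntichainPoset.rel_trans, ⟨Nat.bodd, Primrec.nat_bodd.to_comp, ?_, ?_⟩, ?_⟩
  · exact Set.infinite_of_forall_exists_gt fun N => ⟨2 * N + 1, by simp, by omega⟩
  · intro x y hx hy
    have hodd : ∀ n : ℕ, n.bodd = true → n % 2 = 1 := fun n hn => by
      rw [Nat.mod_two_of_bodd, hn]; rfl
    exact AntichainPoset.rel_eq_false_of_odd (hodd x hx) (hodd y hy)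
  · rintro I hI ⟨χ, hχ, hIχ⟩
    exact AntichainPoset.exists_finset_generating hI hχ hIχ
end
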